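/- Let 0 < λ ≤ 2^{-6}, let Ψ̂ ∈ 𝔽_{L,r} be any frame and set 𝔡(v) := Ψ̂*v for v ∈ ℂ^L. Let P ∈ ℂ^{L×L} with ‖P‖ ≤ 1, W ∈ 𝔾_{L,w}, and v a unit vector with Wv = 0. Then: (i) | ‖𝔡([(e^{λP}·W)^⊥e^{λP}]∘v)‖² − ‖𝔡(v)‖² | ≤ (3/2)λ; (ii) the quantity A_𝔡(W,v,P) := tr(Ψ̂*[X(W+vv*,P) − X(W,P)]Ψ̂) satisfies |A_𝔡(W,v,P)| ≤ 2^{1/2}; and (iii) | ‖𝔡([(e^{λP}·W)^⊥e^{λP}]∘v)‖² − ‖𝔡(v)‖² − λ·A_𝔡(W,v,P) | ≤ 9λ² + 160λ³. -/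

import Mathlib

open Matrix BigOperators

noncomputable section

/-- The squared Euclidean norm of a complex vector. -/
def sqNorm {n : ℕ} (v : Fin n → ℂ) : ℝ := ∑ i, ‖v i‖ ^ 2

/-- The Euclidean norm of a complex vector. -/
def vNorm {n : ℕ} (v : Fin n → ℂ) : ℝ := Real.sqrt (sqNorm v)

/-- The `ℓ² → ℓ²` operator norm of a rectangular complex matrix. -/
def opNorm {m n : ℕ} (A : Matrix (Fin m) (Fin n) ℂ) : ℝ :=
  ‖LinearMap.toContinuousLinearMap (Matrix.toEuclideanLin A)‖

/-- Membership in the Grassmannian `𝔾_{L,q}`: an orthogonal projection of rank `q`. -/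
def IsProjOfRank {L : ℕ} (q : ℕ) (Q : Matrix (Fin L) (Fin L) ℂ) : Prop :=
  Q * Q = Q ∧ Qᴴ = Q ∧ Q.trace = (q : ℂ)

/-- A frame `Φ ∈ 𝔽_{L,q}`. -/
def IsFrame {L q : ℕ} (Φ : Matrix (Fin L) (Fin q) ℂ) : Prop := Φᴴ * Φ = 1

/-- The action `T · Q` of an invertible matrix `T` on the Grassmannian: for `Q = ΦΦ*` this
equals `TΦ(Φ*T*TΦ)⁻¹Φ*T*`, i.e. the orthogonal projection onto `T (ran Q)`. -/
def grAct {L : ℕ} (T Q : Matrix (Fin L) (Fin L) ℂ) : Matrix (Fin L) (Fin L) ℂ :=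
  T * Q * (Q * Tᴴ * T * Q + (1 - Q))⁻¹ * (Q * Tᴴ)

/-- The matrix exponential. -/
def mexp {n : ℕ} (A : Matrix (Fin n) (Fin n) ℂ) : Matrix (Fin n) (Fin n) ℂ :=
  ∑' k : ℕ, ((k.factorial : ℂ))⁻¹ • A ^ k

/-- The normalized image `S ∘ v := Sv / ‖Sv‖`. -/
def circAct {n : ℕ} (S : Matrix (Fin n) (Fin n) ℂ) (v : Fin n → ℂ) : Fin n → ℂ :=
  ((vNorm (S.mulVec v) : ℂ))⁻¹ • S.mulVec v

/-- `X(Q,P) = Q^⊥ P Q + Q P* Q^⊥`. -/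
def Xmap {L : ℕ} (Q P : Matrix (Fin L) (Fin L) ℂ) : Matrix (Fin L) (Fin L) ℂ :=
  (1 - Q) * P * Q + Q * Pᴴ * (1 - Q)

section core
variable {E : Type*} [NormedAddCommGroup E] [InnerProductSpace ℂ E]

lemma core_real {lam s e2 q κ A X2 X3 X4 D : ℝ} (h0 : 0 < lam) (h1 : lam ≤ 1/64)
  (hs0 : 0 ≤ s) (hs : s ≤ 1.43 * lam) (he0 : 0 ≤ e2) (he : e2 ≤ 0.72 * lam^2) (hq0 : 0 ≤ q) (hq : q ≤ 1.4143)
  (hκ1 : 1 - s ≤ κ) (hκ2 : κ ≤ 1 + s) (hA : |A| ≤ q) (hX2 : |X2| ≤ q * s) (hX3 : |X3| ≤ e2)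
  (hX4 : |X4| ≤ s^2) (hD : D = κ^2*lam*A + κ*lam*X2 - κ*X3 + X4) :
  |D - lam * A| ≤ 9 * lam^2 + 160 * lam^3 := by
  have hs1 : s ≤ 0.0224 := by linarith
  have e1 : D - lam * A = (κ^2-1)*(lam*A) + κ*(lam*X2) - κ*X3 + X4 := by rw [hD]; ring
  have hκ0 : 0 ≤ κ := by linarith
  have hk3 : |κ^2-1| ≤ 2.0224 * s := by
    rw [abs_le]; constructor <;> nlinarith
  have hlA : |lam * A| ≤ 1.4143 * lam := by
    rw [abs_mul, abs_of_pos h0]; nlinarith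
  have hlX : |lam * X2| ≤ lam * (1.4143 * (1.43*lam)) := by
    rw [abs_mul, abs_of_pos h0]; gcongr; refine hX2.trans ?_; gcongr
  have t1 : |(κ^2-1)*(lam*A)| ≤ (2.0224 * (1.43*lam)) * (1.4143 * lam) := by
    rw [abs_mul]; gcongr; linarith
  have t2 : |κ*(lam*X2)| ≤ 1.0224 * (lam * (1.4143 * (1.43*lam))) := by
    rw [abs_mul, abs_of_nonneg hκ0]; gcongr; linarith
  have t3 : |κ*X3| ≤ 1.0224 * (0.72 * lam^2) := by
    rw [abs_mul, abs_of_nonneg hκ0]; gcongr; linarith; linarith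
  have t4 : |X4| ≤ (1.43 * lam)^2 := hX4.trans (by gcongr)
  rw [e1]
  have := abs_add_le ((κ^2-1)*(lam*A) + κ*(lam*X2) - κ*X3) X4
  have := abs_sub ((κ^2-1)*(lam*A) + κ*(lam*X2)) (κ*X3)
  have := abs_add_le ((κ^2-1)*(lam*A)) (κ*(lam*X2))
  have h3 : 0 < lam^3 := by positivity
  have h2 : 0 < lam^2 := by positivity
  nlinarith

lemma core_real1 {lam s κ X1 X4 D : ℝ} (h0 : 0 < lam) (h1 : lam ≤ 1/64)
  (hs0 : 0 ≤ s) (hs : s ≤ 1.43 * lam) 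
  (hκ1 : 1 - s ≤ κ) (hκ2 : κ ≤ 1 + s) (hX1 : |X1| ≤ s) 
  (hX4 : |X4| ≤ s^2) (hD : D = κ*X1 + X4) :
  |D| ≤ 3/2*lam := by
  have hs1 : s ≤ 0.0224 := by linarith
  have hκ0 : 0 ≤ κ := by linarith
  have t2 : |κ*X1| ≤ 1.0224 * s := by
    rw [abs_mul, abs_of_nonneg hκ0]; gcongr; linarith
  rw [hD]
  have := abs_add_le (κ*X1) X4
  nlinarith

lemma core (π B : E →L[ℂ] E) (hππ : ∀ x, π (π x) = π x) (hπs : ∀ x y, inner ℂ (π x) y = inner ℂ x (π y))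
  (u v k e : E) (κ lam s e2 A : ℝ) (h0 : 0 < lam) (h1 : lam ≤ 1/64)
  (hs : s ≤ 1.43 * lam) (he : e2 ≤ 0.72 * lam^2)
  (hκ : 0 ≤ κ) (hu : ‖u‖ = 1) (hv : ‖v‖ = 1) (huv : u = (κ:ℂ) • v + k) (hk : ‖k‖ ≤ s)
  (hkB : k = (lam:ℂ) • B u - e) (hB : ∀ x, ‖B x‖ ≤ √2 * ‖x‖) (hee : ‖e‖ ≤ e2)
  (hA : A = 2 * (inner ℂ (π v - ((‖π v‖^2 : ℝ) : ℂ) • v) (B v)).re) :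
  |‖π u‖^2 - ‖π v‖^2| ≤ 3/2*lam ∧ |A| ≤ √2 ∧ |‖π u‖^2 - ‖π v‖^2 - lam*A| ≤ 9 * lam^2 + 160 * lam^3 := by
  have hππ' : ∀ x y, inner ℂ (π x) (π y) = inner ℂ (π x) y := fun x y => by
    rw [← hπs, hππ]
  have hn : ∀ x, ‖π x‖^2 = (inner ℂ (π x) x).re := fun x => by
    rw [← hππ', ← inner_self_eq_norm_sq (𝕜 := ℂ)]; rfl
  have hle : ∀ x, ‖π x‖ ≤ ‖x‖ := fun x => by
    have := re_inner_le_norm (𝕜 := ℂ) (π x) x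
    have h2 := hn x
    change (inner ℂ (π x) x).re ≤ _ at this
    by_contra hc
    push Not at hc
    nlinarith [norm_nonneg x, norm_nonneg (π x)]
  set p := ‖π v‖^2 with hp
  have hp0 : 0 ≤ p := by positivity
  have hp1 : p ≤ 1 := by
    have := hle v; rw [hv] at this
    nlinarith [norm_nonneg (π v)]
  set mu := π v - (p:ℂ) • v with hmu
  have hmun : ‖mu‖ ≤ 1/2 := by
    have : ‖mu‖^2 = p - p^2 := by
      rw [hmu, norm_sub_sq (𝕜 := ℂ), inner_smul_right, norm_smul, hv]
      have : RCLike.re ((p:ℂ) * inner ℂ (π v) v) = p * p := by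
        rw [show RCLike.re ((p:ℂ) * inner ℂ (π v) v) = ((p:ℂ) * inner ℂ (π v) v).re from rfl, Complex.re_ofReal_mul, ← hn]
      rw [this, ← hp]; simp; ring
    nlinarith [norm_nonneg mu, sq_nonneg (p - 1/2)]
  have hin : ∀ x, |2 * (inner ℂ mu x).re| ≤ ‖x‖ := fun x => by
    rw [abs_mul, abs_two]
    have h1 : |(inner ℂ mu x).re| ≤ ‖mu‖ * ‖x‖ := (Complex.abs_re_le_norm _).trans (norm_inner_le_norm _ _)
    have h2 : ‖mu‖ * ‖x‖ ≤ 1/2 * ‖x‖ := by gcongr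
    linarith
  have hs0 : 0 ≤ s := (norm_nonneg _).trans hk
  have he0 : 0 ≤ e2 := (norm_nonneg _).trans hee
  have hκv : ‖(κ:ℂ) • v‖ = κ := by rw [norm_smul, hv]; simp [abs_of_nonneg hκ]
  have hκ1 : 1 - s ≤ κ := by
    have := norm_add_le ((κ:ℂ) • v) k
    rw [← huv, hκv, hu] at this; linarith
  have hκ2 : κ ≤ 1 + s := by
    have : (κ:ℂ) • v = u - k := by rw [huv]; simp
    have h2 := norm_sub_le u k
    rw [← this, hκv, hu] at h2; linarith
  have hA2 : |A| ≤ √2 := by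
    rw [hA]; refine (hin _).trans ((hB v).trans ?_); rw [hv, mul_one]
  set X4 := ‖π k‖^2 - p * ‖k‖^2 with hX4d
  have hX4 : |X4| ≤ s^2 := by
    have h1 : ‖π k‖^2 ≤ ‖k‖^2 := by gcongr; exact hle k
    have h2 : ‖k‖^2 ≤ s^2 := by gcongr
    have : 0 ≤ ‖π k‖^2 := by positivity
    rw [abs_le]; constructor <;> nlinarith [sq_nonneg ‖k‖]
  have hD : ‖π u‖^2 - p = κ * (2 * (inner ℂ mu k).re) + X4 := by
    have a1 : ‖π u‖^2 = κ^2 * p + 2 * κ * (inner ℂ (π v) k).re + ‖π k‖^2 := by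
      rw [huv, map_add, map_smul, norm_add_sq (𝕜 := ℂ), inner_smul_left, hππ', norm_smul]
      simp [hp, mul_pow]; ring
    have a2 : (1:ℝ) = κ^2 + 2 * κ * (inner ℂ v k).re + ‖k‖^2 := by
      have : (1:ℝ) = ‖u‖^2 := by rw [hu]; norm_num
      rw [this, huv, norm_add_sq (𝕜 := ℂ), inner_smul_left, norm_smul, hv]
      simp; ring
    have a3 : (inner ℂ mu k).re = (inner ℂ (π v) k).re - p * (inner ℂ v k).re := by
      rw [hmu, inner_sub_left, inner_smul_left]; simp
    rw [a1, a3, hX4d]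
    linear_combination (-p) * a2
  have hkk : (inner ℂ mu k).re = lam * κ * (inner ℂ mu (B v)).re + lam * (inner ℂ mu (B k)).re
      - (inner ℂ mu e).re := by
    conv_lhs => rw [hkB, huv]
    rw [map_add, map_smul, inner_sub_right, inner_smul_right, inner_add_right, inner_smul_right]
    simp; ring
  refine ⟨core_real1 h0 h1 hs0 hs hκ1 hκ2 ((hin k).trans hk) hX4 hD, hA2, ?_⟩
  refine core_real (X2 := 2 * (inner ℂ mu (B k)).re) (X3 := 2 * (inner ℂ mu e).re) h0 h1 hs0 hs he0 he (Real.sqrt_nonneg 2) ?_ hκ1 hκ2 hA2 ((hin _).trans ((hB k).trans (by gcongr))) ((hin _).trans hee) hX4 ?_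
  · rw [Real.sqrt_le_left] <;> norm_num
  · rw [hD, hkk, hA]; ring
end core

section mid
lemma exp_bound {𝔸 : Type*} [NormedRing 𝔸] [NormedAlgebra ℂ 𝔸] [CompleteSpace 𝔸] (X : 𝔸) (lam : ℝ) (h0 : 0 < lam)
    (h1 : lam ≤ 1/64) (hX : ‖X‖ ≤ lam) :
    ‖NormedSpace.exp X - 1 - X‖ ≤ 0.508 * lam^2 ∧ ‖NormedSpace.exp X - 1‖ ≤ 1.008 * lam := by
  have key : ‖NormedSpace.exp X - 1 - X‖ ≤ 0.508 * lam^2 := by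
    have hs := NormedSpace.exp_series_hasSum_exp' (𝕂 := ℂ) X
    have hs2 := (hasSum_nat_add_iff' 2).2 hs
    have hg : HasSum (fun n : ℕ => lam^2/2 * lam^n) (lam^2/2 * (1-lam)⁻¹) :=
      (hasSum_geometric_of_lt_one h0.le (by linarith)).mul_left _
    have e : NormedSpace.exp X - 1 - X = NormedSpace.exp X - ∑ i ∈ Finset.range 2, ((i.factorial : ℂ)⁻¹) • X ^ i := by
      simp [Finset.sum_range_succ]; abel
    rw [e, ← hs2.tsum_eq]
    have := tsum_of_norm_bounded (f := fun n : ℕ => (((n+2).factorial : ℂ)⁻¹) • X ^ (n+2)) hg (fun n => by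
      rw [norm_smul, norm_inv, Complex.norm_natCast]
      have a1 : ‖X^(n+2)‖ ≤ lam^(n+2) := (norm_pow_le' X (by omega)).trans (by gcongr)
      have a2 : (((n+2).factorial : ℝ))⁻¹ ≤ 2⁻¹ := by
        gcongr
        exact_mod_cast (Nat.factorial_le (show 2 ≤ n+2 by omega))
      calc _ ≤ 2⁻¹ * lam^(n+2) := by gcongr
        _ = _ := by ring)
    refine this.trans ?_
    have : (1-lam)⁻¹ ≤ 1.016 := by
      rw [inv_le_comm₀] <;> norm_num <;> linarith
    nlinarith [sq_nonneg lam]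
  refine ⟨key, ?_⟩
  have : NormedSpace.exp X - 1 = (NormedSpace.exp X - 1 - X) + X := by abel
  rw [this]
  refine (norm_add_le _ _).trans ?_
  nlinarith

variable {E : Type*} [NormedAddCommGroup E] [InnerProductSpace ℂ E]

lemma proj_bound (W : E →L[ℂ] E) (hWW : ∀ x, W (W x) = W x)
    (hWs : ∀ x y, inner ℂ (W x) y = inner ℂ x (W y)) (a b : E) (c : ℝ) (ha : ‖a‖ ≤ c) (hb : ‖b‖ ≤ c) :
    ‖W a + (b - W b)‖ ≤ √2 * c := by
  have hc : 0 ≤ c := (norm_nonneg _).trans ha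
  have orth : ∀ x y, inner ℂ (W x) (y - W y) = 0 := fun x y => by
    rw [inner_sub_right, ← hWs (W x) y, hWW, sub_self]
  have n1 : ∀ x y, ‖W x + (y - W y)‖^2 = ‖W x‖^2 + ‖y - W y‖^2 := fun x y => by
    rw [norm_add_sq (𝕜 := ℂ), orth]; simp
  have h1 := n1 a b
  have h2 := n1 a a
  have h3 := n1 b b
  rw [add_sub_cancel] at h2 h3
  have h4 : ‖W a + (b - W b)‖^2 ≤ (√2 * c)^2 := by
    rw [mul_pow, Real.sq_sqrt (by norm_num), h1]
    have : ‖a‖^2 ≤ c^2 := by gcongr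
    have : ‖b‖^2 ≤ c^2 := by gcongr
    nlinarith [sq_nonneg ‖a - W a‖, sq_nonneg ‖W b‖]
  exact le_of_sq_le_sq h4 (by positivity)

lemma mid (π W P P' T1 T2 : E →L[ℂ] E) (hππ : ∀ x, π (π x) = π x)
  (hπs : ∀ x y, inner ℂ (π x) y = inner ℂ x (π y))
  (hWW : ∀ x, W (W x) = W x) (hWs : ∀ x y, inner ℂ (W x) y = inner ℂ x (W y))
  (z v : E) (lam A : ℝ) (h0 : 0 < lam) (h1 : lam ≤ 1/64)
  (hP : ‖P‖ ≤ 1) (hP' : ‖P'‖ ≤ 1)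
  (hT1 : ‖T1 - 1‖ ≤ 1.008 * lam) (hT1' : ‖T1 - 1 - (lam:ℂ) • P'‖ ≤ 0.508 * lam^2)
  (hT2 : ‖T2 - 1‖ ≤ 1.008 * lam) (hT2' : ‖T2 - 1 - (-(lam:ℂ) • P)‖ ≤ 0.508 * lam^2)
  (hv : ‖v‖ = 1) (hz1 : W (T1 z) = 0) (hz2 : T2 z - W (T2 z) = v)
  (hA : A = 2 * (inner ℂ (π v - ((‖π v‖^2 : ℝ) : ℂ) • v) (P v - W (P v) - W (P' v))).re) :
  |‖π ((‖z‖:ℂ)⁻¹ • z)‖^2 - ‖π v‖^2| ≤ 3/2*lam ∧ |A| ≤ √2 ∧ |‖π ((‖z‖:ℂ)⁻¹ • z)‖^2 - ‖π v‖^2 - lam*A| ≤ 9 * lam^2 + 160 * lam^3 := by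
  have hz : ‖z‖ ≠ 0 := by
    intro h
    rw [norm_eq_zero] at h
    rw [h] at hz2
    simp at hz2
    rw [← hz2] at hv
    simp at hv
  have hq : √2 ≤ 1.4143 := by rw [Real.sqrt_le_left] <;> norm_num
  have hq0 := Real.sqrt_nonneg 2
  set u := (‖z‖:ℂ)⁻¹ • z with hu
  have hun : ‖u‖ = 1 := by
    rw [hu, norm_smul]; simp [hz]
  have opb : ∀ (T : E →L[ℂ] E) (c : ℝ), ‖T‖ ≤ c → ‖T u‖ ≤ c := fun T c h => by
    have := T.le_opNorm u
    rw [hun, mul_one] at this; exact this.trans h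
  have hzz : z = v - (W ((T1 - 1) z) + ((T2 - 1) z - W ((T2-1) z))) := by
    simp only [_root_.sub_apply, one_apply_eq_self, map_sub]
    rw [hz1, ← hz2]; abel
  have huu : u = ((‖z‖⁻¹ : ℝ) : ℂ) • v - (W ((T1 - 1) u) + ((T2 - 1) u - W ((T2-1) u))) := by
    have h := congrArg (fun x => (‖z‖:ℂ)⁻¹ • x) hzz
    simp only [smul_sub, smul_add, ← map_smul, ← hu] at h
    rw [Complex.ofReal_inv]
    exact h
  refine core π (P - W ∘L P - W ∘L P') hππ hπs u v (-(W ((T1 - 1) u) + ((T2 - 1) u - W ((T2-1) u))))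
    (W ((T1 - 1 - (lam:ℂ) • P') u) + ((T2 - 1 - (-(lam:ℂ) • P)) u - W ((T2 - 1 - (-(lam:ℂ) • P)) u)))
    (‖z‖⁻¹) lam (√2 * (1.008 * lam)) (√2 * (0.508 * lam^2)) A h0 h1 (by nlinarith) (by nlinarith [sq_nonneg lam])
    (by positivity) hun hv ?_ ?_ ?_ ?_ ?_ hA
  · rw [← sub_eq_add_neg]; exact huu
  · rw [norm_neg]
    exact proj_bound W hWW hWs _ _ _ (opb _ _ hT1) (opb _ _ hT2)
  · simp only [_root_.sub_apply, one_apply_eq_self, map_sub, _root_.smul_apply,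
      ContinuousLinearMap.comp_apply, map_smul, smul_sub, neg_smul, _root_.neg_apply, map_neg]
    abel
  · intro x
    have := proj_bound W hWW hWs (-P' x) (P x) ‖x‖ (by rw [norm_neg]; exact (P'.le_of_opNorm_le hP' x).trans (by simp))
      ((P.le_of_opNorm_le hP x).trans (by simp))
    convert this using 2
    simp; abel
  · exact proj_bound W hWW hWs _ _ _ (opb _ _ hT1') (opb _ _ hT2')
end mid

section mat
open scoped Matrix.Norms.L2Operator

lemma mexp_eq {n : ℕ} (X : Matrix (Fin n) (Fin n) ℂ) : mexp X = NormedSpace.exp X := by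
  rw [NormedSpace.exp_eq_tsum ℂ]; rfl

lemma mexp_bound {n : ℕ} (X : Matrix (Fin n) (Fin n) ℂ) (lam : ℝ) (h0 : 0 < lam)
    (h1 : lam ≤ 1/64) (hX : ‖X‖ ≤ lam) :
    ‖mexp X - 1 - X‖ ≤ 0.508 * lam^2 ∧ ‖mexp X - 1‖ ≤ 1.008 * lam := by
  rw [mexp_eq]; exact exp_bound X lam h0 h1 hX

lemma mexp_star {n : ℕ} (X : Matrix (Fin n) (Fin n) ℂ) : (mexp X)ᴴ = mexp Xᴴ := by
  rw [mexp_eq, mexp_eq, Matrix.exp_conjTranspose]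

lemma mexp_neg_mul {n : ℕ} (X : Matrix (Fin n) (Fin n) ℂ) : mexp (-X) * mexp X = 1 := by
  rw [mexp_eq, mexp_eq, Matrix.exp_neg]
  exact Matrix.nonsing_inv_mul _ ((Matrix.isUnit_iff_isUnit_det _).1 (Matrix.isUnit_exp X))

lemma opNorm_eq {n : ℕ} (X : Matrix (Fin n) (Fin n) ℂ) : opNorm X = ‖X‖ := rfl

lemma sqNorm_eq {n : ℕ} (x : Fin n → ℂ) : sqNorm x = ‖WithLp.toLp 2 x‖^2 := by
  rw [EuclideanSpace.norm_sq_eq]; rfl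

lemma vNorm_eq {n : ℕ} (x : Fin n → ℂ) : vNorm x = ‖WithLp.toLp 2 x‖ := by
  rw [vNorm, sqNorm_eq, Real.sqrt_sq (norm_nonneg _)]

lemma sqNorm_dot {n : ℕ} (x : Fin n → ℂ) : ((sqNorm x : ℝ) : ℂ) = star x ⬝ᵥ x := by
  simp [sqNorm, dotProduct, Complex.conj_mul']

lemma inner_toLp {n : ℕ} (x y : Fin n → ℂ) :
    inner ℂ (WithLp.toLp 2 x) (WithLp.toLp 2 y) = star x ⬝ᵥ y := by
  rw [EuclideanSpace.inner_toLp_toLp, dotProduct_comm]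

lemma gram_isUnit {L : ℕ} (T S W : Matrix (Fin L) (Fin L) ℂ) (hS : S * T = 1) (hWW : W * W = W)
    (hWh : Wᴴ = W) : IsUnit (W * Tᴴ * T * W + (1 - W)) := by
  rw [← Matrix.mulVec_injective_iff_isUnit]
  refine (injective_iff_map_eq_zero (Matrix.mulVecLin (W * Tᴴ * T * W + (1 - W)))).2 ?_
  intro x hx
  rw [Matrix.mulVecLin_apply] at hx
  have e : W * Tᴴ * T * W + (1 - W) = (T * W)ᴴ * (T * W) + (1-W)ᴴ * (1-W) := by
    simp only [conjTranspose_mul, conjTranspose_sub, conjTranspose_one, hWh]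
    have : (1 - W) * (1 - W) = 1 - W := by
      rw [mul_sub, sub_mul, sub_mul, hWW]; simp
    rw [this]; simp only [mul_assoc]
  have h2 : ((sqNorm ((T * W) *ᵥ x) + sqNorm ((1-W) *ᵥ x) : ℝ) : ℂ) = 0 := by
    have h3 : star x ⬝ᵥ ((W * Tᴴ * T * W + (1 - W)) *ᵥ x) = 0 := by rw [hx]; simp
    have hg : ∀ C : Matrix (Fin L) (Fin L) ℂ, star x ⬝ᵥ ((Cᴴ * C) *ᵥ x) = ((sqNorm (C *ᵥ x) : ℝ) : ℂ) := by
      intro C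
      rw [← mulVec_mulVec, dotProduct_mulVec, ← star_mulVec, ← sqNorm_dot]
    rw [e, add_mulVec, dotProduct_add, hg, hg] at h3
    rw [← h3]; push_cast; rfl
  have h3 : sqNorm ((T * W) *ᵥ x) + sqNorm ((1-W) *ᵥ x) = 0 := by exact_mod_cast h2
  rw [sqNorm_eq, sqNorm_eq] at h3
  have a1 : (T * W) *ᵥ x = 0 := by
    have : ‖WithLp.toLp 2 ((T * W) *ᵥ x)‖ = 0 := by nlinarith [sq_nonneg ‖WithLp.toLp 2 ((T * W) *ᵥ x)‖, sq_nonneg ‖WithLp.toLp 2 ((1 - W) *ᵥ x)‖]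
    simpa using this
  have a2 : (1 - W) *ᵥ x = 0 := by
    have : ‖WithLp.toLp 2 ((1 - W) *ᵥ x)‖ = 0 := by nlinarith [sq_nonneg ‖WithLp.toLp 2 ((T * W) *ᵥ x)‖, sq_nonneg ‖WithLp.toLp 2 ((1 - W) *ᵥ x)‖]
    simpa using this
  have a3 : W *ᵥ x = 0 := by
    have : S *ᵥ ((T * W) *ᵥ x) = W *ᵥ x := by rw [mulVec_mulVec, ← mul_assoc, hS, one_mul]
    rw [← this, a1, mulVec_zero]
  rw [sub_mulVec, a3] at a2
  simpa using a2

lemma z_eqs {L : ℕ} (T S W : Matrix (Fin L) (Fin L) ℂ) (hS : S * T = 1) (hWW : W * W = W)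
    (hWh : Wᴴ = W) : W * (Tᴴ * ((1 - grAct T W) * T)) = 0 ∧
      (1 - W) * (S * ((1 - grAct T W) * T)) = 1 - W := by
  have hN := gram_isUnit T S W hS hWW hWh
  set N := W * Tᴴ * T * W + (1 - W) with hNd
  have hNN : N * N⁻¹ = 1 := Matrix.mul_nonsing_inv _ ((Matrix.isUnit_iff_isUnit_det _).1 hN)
  have hWN : W * N = W * Tᴴ * T * W := by
    rw [hNd, mul_add, mul_sub, hWW, mul_one, sub_self, add_zero]
    simp only [← mul_assoc, hWW]
  have hg : grAct T W = T * W * N⁻¹ * (W * Tᴴ) := rfl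
  constructor
  · have : W * (Tᴴ * (grAct T W * T)) = W * (Tᴴ * T) := by
      calc _ = (W * Tᴴ * T * W) * N⁻¹ * (W * Tᴴ) * T := by rw [hg]; simp only [mul_assoc]
        _ = W * (N * N⁻¹) * (W * Tᴴ) * T := by rw [← hWN]; simp only [mul_assoc]
        _ = (W * W) * (Tᴴ * T) := by rw [hNN]; simp only [mul_assoc, mul_one, one_mul]
        _ = _ := by rw [hWW]
    rw [sub_mul, one_mul, mul_sub, mul_sub, this, sub_self]
  · have : (1 - W) * (S * (grAct T W * T)) = 0 := by
      calc _ = (1 - W) * (S * T) * W * (N⁻¹ * (W * Tᴴ) * T) := by rw [hg]; simp only [mul_assoc]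
        _ = 0 := by rw [hS, mul_one, sub_mul 1 W W, hWW, one_mul, sub_self, zero_mul]
    rw [sub_mul 1 (grAct T W), one_mul, mul_sub S, mul_sub (1 - W), this, hS, sub_zero, mul_one]

lemma trace_V {L : ℕ} (M : Matrix (Fin L) (Fin L) ℂ) (v : Fin L → ℂ) :
    (M * vecMulVec v (star v)).trace = star v ⬝ᵥ (M *ᵥ v) := by
  rw [mul_vecMulVec, trace_vecMulVec, dotProduct_comm]

lemma q_star {L : ℕ} (M : Matrix (Fin L) (Fin L) ℂ) (v : Fin L → ℂ) :
    star v ⬝ᵥ (Mᴴ *ᵥ v) = star (star v ⬝ᵥ (M *ᵥ v)) := by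
  rw [dotProduct_mulVec, ← star_mulVec, ← star_dotProduct_star, star_star, dotProduct_comm]

lemma trace_A {L r : ℕ} (Ψ : Matrix (Fin L) (Fin r) ℂ) (P W : Matrix (Fin L) (Fin L) ℂ)
    (hWh : Wᴴ = W) (v : Fin L → ℂ) (hWv : W *ᵥ v = 0) (p : ℝ)
    (hp : star v ⬝ᵥ ((Ψ * Ψᴴ) *ᵥ v) = p) :
    ((Ψᴴ * (Xmap (W + Matrix.vecMulVec v (star v)) P - Xmap W P) * Ψ).trace).re =
      2 * (star v ⬝ᵥ (((Ψ * Ψᴴ) * ((1 - W) * P - W * Pᴴ)) *ᵥ v) -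
        p * (star v ⬝ᵥ (((1 - W) * P - W * Pᴴ) *ᵥ v))).re := by
  set V := vecMulVec v (star v) with hV
  set Q := Ψ * Ψᴴ with hQ
  have hQh : Qᴴ = Q := by simp [hQ]
  have hVh : Vᴴ = V := by simp [hV, conjTranspose_vecMulVec]
  set K := (1 - W) * P * V - V * P * W - V * P * V with hK
  have hX : Xmap (W + V) P - Xmap W P = K + Kᴴ := by
    simp only [hK, Xmap, conjTranspose_sub, conjTranspose_mul, hVh, hWh, conjTranspose_one]
    noncomm_ring
  have ht : (Ψᴴ * (Xmap (W + V) P - Xmap W P) * Ψ).trace = (K * Q).trace + star (K * Q).trace := by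
    rw [trace_mul_comm, ← Matrix.mul_assoc, ← hQ, hX, mul_add, trace_add, trace_mul_comm Q K,
      ← trace_conjTranspose, conjTranspose_mul, hQh]
  have hVQV : V * Q * V = (p : ℂ) • V := by
    rw [hV, mul_assoc, mul_vecMulVec, vecMulVec_mul_vecMulVec, hp]
    ext i j; simp [vecMulVec_apply]; ring
  have hKQ : (K * Q).trace = star v ⬝ᵥ ((Q * ((1 - W) * P)) *ᵥ v) - star v ⬝ᵥ ((P * W * Q) *ᵥ v)
      - p * (star v ⬝ᵥ (P *ᵥ v)) := by
    rw [hK, sub_mul, sub_mul, trace_sub, trace_sub]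
    congr 1
    · congr 1
      · rw [trace_mul_comm, ← mul_assoc, trace_V]
      · rw [mul_assoc, mul_assoc, trace_mul_comm, trace_V, ← mul_assoc]
    · rw [mul_assoc, mul_assoc, trace_mul_comm, mul_assoc, mul_assoc, ← mul_assoc V Q V, hVQV, mul_smul_comm,
        trace_smul, trace_V, smul_eq_mul]
  have hW1 : ∀ M, star v ⬝ᵥ ((W * M) *ᵥ v) = 0 := fun M => by
    have := q_star (Mᴴ * W) v
    rw [conjTranspose_mul, conjTranspose_conjTranspose, hWh] at this
    rw [this, ← mulVec_mulVec, hWv]; simp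
  have hP2 : star v ⬝ᵥ ((P * W * Q) *ᵥ v) = star (star v ⬝ᵥ ((Q * (W * Pᴴ)) *ᵥ v)) := by
    rw [← q_star]; simp [conjTranspose_mul, hWh, hQh]
  have hBv : star v ⬝ᵥ (((1 - W) * P - W * Pᴴ) *ᵥ v) = star v ⬝ᵥ (P *ᵥ v) := by
    rw [sub_mul, one_mul, sub_mulVec, sub_mulVec, dotProduct_sub, dotProduct_sub, hW1, hW1]; simp
  rw [ht, hKQ, hP2, hBv, mul_sub Q, sub_mulVec, dotProduct_sub]
  simp
  ring
end mat

open scoped Matrix.Norms.L2Operator in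
/-- expansion of the perturbation for the auxiliary dynamics:
with `𝔡(v) = Ψ̂*v` and `u = [(e^{λP}·W)^⊥ e^{λP}] ∘ v`, one has
`| ‖𝔡(u)‖² − ‖𝔡(v)‖² | ≤ (3/2)λ`, `|A_𝔡(W,v,P)| ≤ √2` and
`| ‖𝔡(u)‖² − ‖𝔡(v)‖² − λ A_𝔡(W,v,P) | ≤ 9λ² + 160λ³`, where
`A_𝔡(W,v,P) = tr(Ψ̂*[X(W+vv*,P) − X(W,P)]Ψ̂)`. -/
theorem statement9 (L r w : ℕ) (lam : ℝ) (hlam0 : 0 < lam) (hlam : lam ≤ 1 / 2 ^ 6)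
    (Ψ : Matrix (Fin L) (Fin r) ℂ) (hΨ : IsFrame Ψ)
    (P : Matrix (Fin L) (Fin L) ℂ) (hP : opNorm P ≤ 1)
    (W : Matrix (Fin L) (Fin L) ℂ) (hW : IsProjOfRank w W)
    (v : Fin L → ℂ) (hv : sqNorm v = 1) (hWv : W.mulVec v = 0)
    (u : Fin L → ℂ)
    (hu : u = circAct ((1 - grAct (mexp ((lam : ℂ) • P)) W) * mexp ((lam : ℂ) • P)) v)
    (A : ℝ)
    (hA : A = ((Ψᴴ * (Xmap (W + Matrix.vecMulVec v (star v)) P - Xmap W P) * Ψ).trace).re) :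
    |sqNorm (Ψᴴ.mulVec u) - sqNorm (Ψᴴ.mulVec v)| ≤ 3 / 2 * lam ∧
    |A| ≤ Real.sqrt 2 ∧
    |sqNorm (Ψᴴ.mulVec u) - sqNorm (Ψᴴ.mulVec v) - lam * A| ≤ 9 * lam ^ 2 + 160 * lam ^ 3 := by
  obtain ⟨hWW, hWh, -⟩ := hW
  rw [opNorm_eq] at hP
  have h1 : lam ≤ 1/64 := by norm_num at hlam ⊢; exact hlam
  set Q := Ψ * Ψᴴ with hQ
  have hQQ : Q * Q = Q := by
    have h : Ψᴴ * Ψ = 1 := hΨ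
    calc Q * Q = Ψ * (Ψᴴ * Ψ) * Ψᴴ := by rw [hQ]; simp only [Matrix.mul_assoc]
      _ = Q := by rw [h, Matrix.mul_one]
  have hQh : Qᴴ = Q := by simp [hQ]
  have hsym : ∀ M : Matrix (Fin L) (Fin L) ℂ, Mᴴ = M → ∀ x y : EuclideanSpace ℂ (Fin L),
      inner ℂ (toEuclideanCLM (n := Fin L) (𝕜 := ℂ) M x) y = inner ℂ x (toEuclideanCLM (n := Fin L) (𝕜 := ℂ) M y) := by
    intro M hM x y
    rw [← ContinuousLinearMap.adjoint_inner_left, ← ContinuousLinearMap.star_eq_adjoint, ← map_star]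
    rw [star_eq_conjTranspose, hM]
  have hidem : ∀ M : Matrix (Fin L) (Fin L) ℂ, M * M = M → ∀ x : EuclideanSpace ℂ (Fin L),
      toEuclideanCLM (n := Fin L) (𝕜 := ℂ) M (toEuclideanCLM (n := Fin L) (𝕜 := ℂ) M x) = toEuclideanCLM (n := Fin L) (𝕜 := ℂ) M x := by
    intro M hM x
    rw [← mul_apply_eq_comp, ← map_mul, hM]
  have hsq : ∀ x : Fin L → ℂ, sqNorm (Ψᴴ *ᵥ x) = ‖toEuclideanCLM (n := Fin L) (𝕜 := ℂ) Q (WithLp.toLp 2 x)‖^2 := by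
    intro x
    rw [toEuclideanCLM_toLp, ← sqNorm_eq]
    have : ((sqNorm (Ψᴴ *ᵥ x) : ℝ) : ℂ) = ((sqNorm (Q *ᵥ x) : ℝ) : ℂ) := by
      rw [sqNorm_dot, sqNorm_dot, star_mulVec, star_mulVec, ← dotProduct_mulVec, ← dotProduct_mulVec,
        mulVec_mulVec, mulVec_mulVec, hQh, hQQ, conjTranspose_conjTranspose]
    exact_mod_cast this
  have hp : star v ⬝ᵥ ((Ψ * Ψᴴ) *ᵥ v) = ((‖toEuclideanCLM (n := Fin L) (𝕜 := ℂ) Q (WithLp.toLp 2 v)‖^2 : ℝ) : ℂ) := by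
    rw [← hsq, sqNorm_dot, star_mulVec, ← dotProduct_mulVec, mulVec_mulVec, conjTranspose_conjTranspose]
  rw [trace_A Ψ P W hWh v hWv _ hp] at hA
  set T := mexp ((lam : ℂ) • P) with hT
  have hS : mexp (-((lam : ℂ) • P)) * T = 1 := mexp_neg_mul _
  obtain ⟨hz1, hz2⟩ := z_eqs T _ W hS hWW hWh
  set Z := (1 - grAct T W) * T with hZ
  have hPh : ‖Pᴴ‖ ≤ 1 := by rw [Matrix.l2_opNorm_conjTranspose]; exact hP
  have hTh : Tᴴ = mexp ((lam : ℂ) • Pᴴ) := by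
    rw [hT, mexp_star, conjTranspose_smul]; simp
  have nsm : ∀ M : Matrix (Fin L) (Fin L) ℂ, ‖M‖ ≤ 1 → ‖(lam:ℂ) • M‖ ≤ lam := fun M hM => by
    rw [norm_smul, Complex.norm_real, Real.norm_of_nonneg hlam0.le]; nlinarith
  obtain ⟨b1, b2⟩ := mexp_bound ((lam : ℂ) • Pᴴ) lam hlam0 h1 (nsm _ hPh)
  obtain ⟨b3, b4⟩ := mexp_bound (-((lam : ℂ) • P)) lam hlam0 h1 (by rw [norm_neg]; exact nsm _ hP)
  have hu2 : WithLp.toLp 2 u = ((‖WithLp.toLp 2 (Z *ᵥ v)‖ : ℂ))⁻¹ • WithLp.toLp 2 (Z *ᵥ v) := by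
    rw [hu, circAct, vNorm_eq]; rfl
  rw [hsq, hsq, hu2]
  refine mid (toEuclideanCLM (n := Fin L) (𝕜 := ℂ) Q) (toEuclideanCLM (n := Fin L) (𝕜 := ℂ) W)
    (toEuclideanCLM (n := Fin L) (𝕜 := ℂ) P) (toEuclideanCLM (n := Fin L) (𝕜 := ℂ) Pᴴ)
    (toEuclideanCLM (n := Fin L) (𝕜 := ℂ) (mexp ((lam : ℂ) • Pᴴ)))
    (toEuclideanCLM (n := Fin L) (𝕜 := ℂ) (mexp (-((lam : ℂ) • P))))
    (hidem _ hQQ) (hsym _ hQh) (hidem _ hWW) (hsym _ hWh) _ _ lam A hlam0 h1 hP hPh ?_ ?_ ?_ ?_ ?_ ?_ ?_ ?_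
  · rw [← map_one (toEuclideanCLM (n := Fin L) (𝕜 := ℂ)), ← map_sub]; exact b2
  · rw [← map_one (toEuclideanCLM (n := Fin L) (𝕜 := ℂ)), ← map_smul, ← map_sub, ← map_sub]; exact b1
  · rw [← map_one (toEuclideanCLM (n := Fin L) (𝕜 := ℂ)), ← map_sub]; exact b4
  · rw [← map_one (toEuclideanCLM (n := Fin L) (𝕜 := ℂ)), ← map_smul, ← map_sub, ← map_sub, neg_smul]; exact b3
  · rw [sqNorm_eq] at hv
    nlinarith [norm_nonneg (WithLp.toLp 2 v)]
  · rw [toEuclideanCLM_toLp, toEuclideanCLM_toLp, mulVec_mulVec, mulVec_mulVec, ← hTh, mul_assoc, hz1]; simp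
  · rw [toEuclideanCLM_toLp, toEuclideanCLM_toLp, ← WithLp.toLp_sub, mulVec_mulVec, mulVec_mulVec, ← sub_mulVec]
    have : mexp (-((lam : ℂ) • P)) * Z - W * (mexp (-((lam : ℂ) • P)) * Z) = 1 - W := by
      rw [← hz2, sub_mul 1 W, one_mul]
    rw [this, sub_mulVec, hWv]; simp
  · rw [hA]
    simp only [toEuclideanCLM_toLp, ← WithLp.toLp_sub, ← WithLp.toLp_smul]
    rw [inner_toLp, star_sub, sub_dotProduct, star_smul, smul_dotProduct, star_mulVec, ← dotProduct_mulVec, hQh]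
    have e : P *ᵥ v - W *ᵥ P *ᵥ v - W *ᵥ Pᴴ *ᵥ v = ((1 - W) * P - W * Pᴴ) *ᵥ v := by
      rw [sub_mulVec, sub_mul, sub_mulVec, one_mul, mulVec_mulVec, mulVec_mulVec]
    rw [e, mulVec_mulVec, ← hQ]
    simp

end
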